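/- Let a ∈ (0,1) be a real number. Then ∑_{n=1}^{∞} L( 4·a²·(1-a²)^n / ((1+a)^{n+1} - (1-a)^{n+1})² ) = L((1-a)/(1+a)). -/

import Mathlib

/-- The Rogers dilogarithm on `[0,1]`: `L(x) = Li₂(x) + (1/2)·log x · log (1-x)`
for `0 < x < 1`, with `L 0 = 0` and `L 1 = π²/6`. -/
noncomputable def rogersL (x : ℝ) : ℝ :=
  if x = 0 then 0
  else if x = 1 then Real.pi ^ 2 / 6
  else (∑' n : ℕ, x ^ (n + 1) / ((n : ℝ) + 1) ^ 2) + 1 / 2 * Real.log x * Real.log (1 - x)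

open Filter Topology Set

lemma summable_inv_succ_sq : Summable fun n : ℕ => 1 / ((n : ℝ) + 1) ^ 2 := by
  have h := (summable_nat_add_iff 1).2 (Real.summable_one_div_nat_pow.2 (one_lt_two))
  simpa using h

lemma rogersL_eq (x : ℝ) : rogersL x =
    (∑' n : ℕ, x ^ (n + 1) / ((n : ℝ) + 1) ^ 2) + 1 / 2 * (Real.log x * Real.log (1 - x)) := by
  unfold rogersL
  split_ifs with h0 h1
  · simp [h0]
  · subst h1
    have h := (hasSum_nat_add_iff' 1).2 hasSum_zeta_two
    have h' := h.tsum_eq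
    simp at h'
    simp [h']
  · ring

lemma rogersL_zero : rogersL 0 = 0 := by simp [rogersL]

lemma rogersL_one : rogersL 1 = Real.pi ^ 2 / 6 := by simp [rogersL]

lemma rogersL_nonneg {x : ℝ} (h0 : 0 ≤ x) (h1 : x ≤ 1) : 0 ≤ rogersL x := by
  rw [rogersL_eq]
  have := mul_nonneg_of_nonpos_of_nonpos (Real.log_nonpos h0 h1)
    (Real.log_nonpos (sub_nonneg.2 h1) (by linarith : 1 - x ≤ 1))
  have : 0 ≤ ∑' n : ℕ, x ^ (n + 1) / ((n : ℝ) + 1) ^ 2 := tsum_nonneg fun n => by positivity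
  linarith

lemma continuousAt_log_mul_log_one_sub {x : ℝ} (hx : x < 1) :
    ContinuousAt (fun t : ℝ => Real.log t * Real.log (1 - t)) x := by
  rcases eq_or_ne x 0 with rfl | h
  · have hd : DifferentiableAt ℝ (fun t : ℝ => Real.log (1 - t)) 0 :=
      (((hasDerivAt_id (0 : ℝ)).const_sub 1).log (by simp)).differentiableAt
    have hc := (Real.continuous_mul_log.continuousAt (x := 0)).mul
      (continuousAt_dslope_same.2 hd)
    refine hc.congr (Eventually.of_forall fun t => ?_)
    have := sub_smul_dslope (fun t : ℝ => Real.log (1 - t)) 0 t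
    simp only [sub_zero, Real.log_one, smul_eq_mul] at this
    simp only [Pi.mul_apply]
    rw [← this]
    ring
  · exact (Real.continuousAt_log h).mul
      ((continuousAt_const.sub continuousAt_id).log (by simp; linarith))

lemma continuousOn_rogersL : ContinuousOn rogersL (Icc 0 1) := by
  have h : rogersL = fun x => (∑' n : ℕ, x ^ (n + 1) / ((n : ℝ) + 1) ^ 2) +
      1 / 2 * (Real.log x * Real.log (1 - x)) := funext rogersL_eq
  rw [h]
  refine ContinuousOn.add ?_ (continuousOn_const.mul ?_)
  · refine continuousOn_tsum (u := fun n : ℕ => 1 / ((n : ℝ) + 1) ^ 2)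
      (fun n => by fun_prop) summable_inv_succ_sq ?_
    intro n x hx
    rw [Real.norm_of_nonneg (by have := hx.1; positivity)]
    gcongr
    exact pow_le_one₀ hx.1 hx.2
  · intro x hx
    apply ContinuousAt.continuousWithinAt
    rcases hx.2.lt_or_eq with h1 | rfl
    · exact continuousAt_log_mul_log_one_sub h1
    · have hc : ContinuousAt (fun t : ℝ => Real.log t * Real.log (1 - t)) (1 - 1) :=
        continuousAt_log_mul_log_one_sub (by norm_num)
      have := ContinuousAt.comp (f := fun t : ℝ => 1 - t) (x := 1) hc (by fun_prop)
      refine this.congr (Eventually.of_forall fun t => ?_)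
      simp [mul_comm]

lemma hasDerivAt_tsum_pow_div_sq {x : ℝ} (h0 : 0 < x) (h1 : x < 1) :
    HasDerivAt (fun x : ℝ => ∑' n : ℕ, x ^ (n + 1) / ((n : ℝ) + 1) ^ 2)
      (-Real.log (1 - x) / x) x := by
  obtain ⟨r, hxr, hr1⟩ := exists_between h1
  have hr0 : 0 < r := h0.trans hxr
  have key := hasDerivAt_tsum_of_isPreconnected (𝕜 := ℝ) (u := fun n : ℕ => r ^ n)
    (g := fun (n : ℕ) (x : ℝ) => x ^ (n + 1) / ((n : ℝ) + 1) ^ 2)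
    (g' := fun (n : ℕ) (x : ℝ) => x ^ n / ((n : ℝ) + 1)) (t := Ioo 0 r) (y₀ := x) (y := x)
    (summable_geometric_of_lt_one hr0.le hr1) isOpen_Ioo isPreconnected_Ioo ?_ ?_ ⟨h0, hxr⟩ ?_
    ⟨h0, hxr⟩
  · refine key.congr_deriv ?_
    have h := (Real.hasSum_pow_div_log_of_abs_lt_one (x := x)
      (by rwa [abs_of_pos h0])).div_const x
    rw [← h.tsum_eq]
    congr 1
    ext n
    rw [pow_succ]
    field_simp
  · intro n y hy
    have h := (hasDerivAt_pow (n + 1) y).div_const (((n : ℝ) + 1) ^ 2)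
    refine h.congr_deriv ?_
    push_cast
    field_simp
  · intro n y hy
    rw [Real.norm_of_nonneg (by have := hy.1; positivity)]
    have : y ^ n ≤ r ^ n := pow_le_pow_left₀ hy.1.le hy.2.le n
    refine (div_le_self (by have := hy.1; positivity) ?_).trans this
    have : (0 : ℝ) ≤ n := n.cast_nonneg
    linarith
  · refine Summable.of_nonneg_of_le (fun n => by positivity) (fun n => ?_) summable_inv_succ_sq
    gcongr
    exact pow_le_one₀ h0.le h1.le

lemma hasDerivAt_rogersL {x : ℝ} (h0 : 0 < x) (h1 : x < 1) :
    HasDerivAt rogersL (-(1 / 2) * (Real.log (1 - x) / x + Real.log x / (1 - x))) x := by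
  have h : rogersL = fun x => (∑' n : ℕ, x ^ (n + 1) / ((n : ℝ) + 1) ^ 2) +
      1 / 2 * (Real.log x * Real.log (1 - x)) := funext rogersL_eq
  have h2 : 1 - x ≠ 0 := by linarith
  rw [h]
  have hd := (hasDerivAt_tsum_pow_div_sq h0 h1).add
    (((Real.hasDerivAt_log h0.ne').mul
      (((hasDerivAt_id x).const_sub 1).log h2)).const_mul (1 / 2))
  refine hd.congr_deriv ?_
  simp only [id]
  field_simp
  ring

lemma eq_of_hasDerivAt_zero {f : ℝ → ℝ} {a b : ℝ} (hab : a < b) (hc : ContinuousOn f (Icc a b))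
    (hd : ∀ x ∈ Ioo a b, HasDerivAt f 0 x) : f b = f a := by
  obtain ⟨c, _, hc⟩ := exists_hasDerivAt_eq_slope f (fun _ => 0) hab hc hd
  have : b - a ≠ 0 := by linarith
  field_simp at hc
  linarith

lemma rogersL_add_rogersL_one_sub {x : ℝ} (h0 : 0 < x) (h1 : x < 1) :
    rogersL x + rogersL (1 - x) = Real.pi ^ 2 / 6 := by
  have h := eq_of_hasDerivAt_zero (f := fun t => rogersL t + rogersL (1 - t)) h0 ?_ ?_
  · simpa [rogersL_zero, rogersL_one] using h
  · refine (continuousOn_rogersL.mono fun t ht => ⟨ht.1, ht.2.trans h1.le⟩).add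
      (continuousOn_rogersL.comp (by fun_prop) fun t ht => ?_)
    constructor <;> linarith [ht.1, ht.2]
  · intro t ht
    have ht1 : t < 1 := ht.2.trans h1
    have hd := (hasDerivAt_rogersL ht.1 ht1).add
      ((hasDerivAt_rogersL (x := 1 - t) (by linarith) (by linarith [ht.1])).comp t
        ((hasDerivAt_id t).const_sub 1))
    refine hd.congr_deriv ?_
    rw [sub_sub_cancel]
    ring

/-- Abel's five-term relation. -/
lemma rogersL_five_term {x y : ℝ} (hx0 : 0 < x) (hx1 : x < 1) (hy0 : 0 < y) (hy1 : y < 1) :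
    rogersL x + rogersL y = rogersL (x * y) + rogersL (x * (1 - y) / (1 - x * y)) +
      rogersL (y * (1 - x) / (1 - x * y)) := by
  have hy2 : 0 < 1 - y := by linarith
  have hxy : ∀ t, t ≤ x → 0 < 1 - t * y := fun t ht => by nlinarith
  have h := eq_of_hasDerivAt_zero (f := fun t => rogersL t - rogersL (t * y) -
    rogersL (t * (1 - y) / (1 - t * y)) - rogersL (y * (1 - t) / (1 - t * y))) hx0 ?_ ?_
  · simp [rogersL_zero] at h
    linarith
  · have hden : ∀ t ∈ Icc 0 x, 1 - t * y ≠ 0 := fun t ht => (hxy t ht.2).ne'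
    refine (((continuousOn_rogersL.mono fun t ht => ⟨ht.1, ht.2.trans hx1.le⟩).sub
      (continuousOn_rogersL.comp (by fun_prop) fun t ht => ?_)).sub
      (continuousOn_rogersL.comp (ContinuousOn.div (by fun_prop) (by fun_prop) hden)
        fun t ht => ?_)).sub
      (continuousOn_rogersL.comp (ContinuousOn.div (by fun_prop) (by fun_prop) hden)
        fun t ht => ?_)
    all_goals
      have h3 := hxy t ht.2
      have h4 := ht.1
      have h5 : 0 ≤ 1 - t := by linarith [ht.2]
    · exact ⟨by positivity, by linarith⟩
    · exact ⟨div_nonneg (by positivity) h3.le, (div_le_one h3).2 (by linarith)⟩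
    · exact ⟨div_nonneg (by positivity) h3.le, (div_le_one h3).2 (by linarith)⟩
  · intro t ht
    have ht0 : 0 < t := ht.1
    have ht2 : 0 < 1 - t := by linarith [ht.2]
    have hd := hxy t ht.2.le
    have e1 : 1 - t * (1 - y) / (1 - t * y) = (1 - t) / (1 - t * y) := by
      rw [eq_div_iff hd.ne', sub_mul, div_mul_cancel₀ _ hd.ne']; ring
    have e2 : 1 - y * (1 - t) / (1 - t * y) = (1 - y) / (1 - t * y) := by
      rw [eq_div_iff hd.ne', sub_mul, div_mul_cancel₀ _ hd.ne']; ring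
    have p1 : 0 < 1 - t * (1 - y) / (1 - t * y) := by rw [e1]; positivity
    have p2 : 0 < 1 - y * (1 - t) / (1 - t * y) := by rw [e2]; positivity
    have d0 : HasDerivAt (fun t => t * y) y t := by
      simpa using (hasDerivAt_id t).mul_const y
    have d1 : HasDerivAt (fun t => t * (1 - y) / (1 - t * y)) ((1 - y) / (1 - t * y) ^ 2) t := by
      refine (((hasDerivAt_id t).mul_const (1 - y)).div (d0.const_sub 1) hd.ne').congr_deriv ?_
      simp only [id]; ring
    have d2 : HasDerivAt (fun t => y * (1 - t) / (1 - t * y))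
        (-(y * (1 - y)) / (1 - t * y) ^ 2) t := by
      refine ((((hasDerivAt_id t).const_sub 1).const_mul y).div (d0.const_sub 1)
        hd.ne').congr_deriv ?_
      simp only [id]; ring
    have D := (((hasDerivAt_rogersL ht0 (by linarith)).sub
      ((hasDerivAt_rogersL (x := t * y) (by positivity) (by linarith)).comp t d0)).sub
      ((hasDerivAt_rogersL (x := t * (1 - y) / (1 - t * y)) (by positivity)
        (by linarith)).comp t d1)).sub
      ((hasDerivAt_rogersL (x := y * (1 - t) / (1 - t * y)) (by positivity)
        (by linarith)).comp t d2)
    refine D.congr_deriv ?_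
    rw [e1, e2, Real.log_div (by positivity) hd.ne', Real.log_div (by positivity) hd.ne',
      Real.log_div (by positivity) hd.ne', Real.log_div (by positivity) hd.ne',
      Real.log_mul ht0.ne' hy0.ne', Real.log_mul ht0.ne' hy2.ne', Real.log_mul hy0.ne' ht2.ne']
    have := hd.ne'
    have := ht2.ne'
    have := hy2.ne'
    field_simp
    ring

/-- The `q`-form of the identity, with `q = (1 - a) / (1 + a)`. -/
lemma hasSum_rogersL_q {q : ℝ} (h0 : 0 < q) (h1 : q < 1) :
    HasSum (fun n : ℕ => rogersL ((1 - q) ^ 2 * q ^ (n + 1) / (1 - q ^ (n + 2)) ^ 2))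
      (rogersL q) := by
  set u : ℕ → ℝ := fun n => (1 - q) / (1 - q ^ (n + 2)) with hu
  set v : ℕ → ℝ := fun n => q ^ (n + 1) * (1 - q) / (1 - q ^ (n + 2)) with hv
  have hq : 0 < 1 - q := by linarith
  have hpow : ∀ n : ℕ, 0 < 1 - q ^ (n + 1) := fun n => by
    exact sub_pos.2 (pow_lt_one₀ h0.le h1 n.succ_ne_zero)
  have hu0 : ∀ n, 0 < u n := fun n => div_pos hq (hpow (n + 1))
  have hv0 : ∀ n, 0 < v n := fun n => div_pos (by positivity) (hpow (n + 1))
  have eu : ∀ n, 1 - u n = q * (1 - q ^ (n + 1)) / (1 - q ^ (n + 2)) := fun n => by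
    have : 1 - q ^ (n + 2) ≠ 0 := (hpow (n + 1)).ne'
    simp only [hu]; field_simp; ring
  have ev : ∀ n, 1 - v n = (1 - q ^ (n + 1)) / (1 - q ^ (n + 2)) := fun n => by
    have : 1 - q ^ (n + 2) ≠ 0 := (hpow (n + 1)).ne'
    simp only [hv]; field_simp; ring
  have hu1 : ∀ n, u n < 1 := fun n => by
    have : 0 < 1 - u n := by rw [eu]; exact div_pos (mul_pos h0 (hpow n)) (hpow (n + 1))
    linarith
  have hv1 : ∀ n, v n < 1 := fun n => by
    have : 0 < 1 - v n := by rw [ev]; exact div_pos (hpow n) (hpow (n + 1))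
    linarith
  have euv : ∀ n, u n * v n = (1 - q) ^ 2 * q ^ (n + 1) / (1 - q ^ (n + 2)) ^ 2 := fun n => by
    simp only [hu, hv]; rw [div_mul_div_comm]; congr 1 <;> ring
  have euv1 : ∀ n, 1 - u n * v n =
      (1 - q ^ (n + 1)) * (1 - q ^ (n + 3)) / (1 - q ^ (n + 2)) ^ 2 := fun n => by
    have : 1 - q ^ (n + 2) ≠ 0 := (hpow (n + 1)).ne'
    rw [euv]; field_simp; ring
  have step : ∀ n, rogersL (u n * v n) =
      (rogersL (u n) + rogersL (v n)) - (rogersL (u (n + 1)) + rogersL (v (n + 1))) := fun n => by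
    have a1 := (hpow n).ne'
    have a2 : 1 - q ^ (n + 2) ≠ 0 := (hpow (n + 1)).ne'
    have a3 : 1 - q ^ (n + 3) ≠ 0 := (hpow (n + 2)).ne'
    have h := rogersL_five_term (hu0 n) (hu1 n) (hv0 n) (hv1 n)
    have b1 : u n * (1 - v n) / (1 - u n * v n) = u (n + 1) := by
      rw [euv1, ev]; simp only [hu]; field_simp
    have b2 : v n * (1 - u n) / (1 - u n * v n) = v (n + 1) := by
      rw [euv1, eu]; simp only [hv]; field_simp; ring
    rw [b1, b2] at h
    linarith
  have hlim : Tendsto (fun n : ℕ => q ^ n) atTop (𝓝 0) :=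
    tendsto_pow_atTop_nhds_zero_of_lt_one h0.le h1
  have hden : Tendsto (fun n : ℕ => 1 - q ^ (n + 2)) atTop (𝓝 1) := by
    simpa using ((tendsto_add_atTop_iff_nat 2).2 hlim).const_sub 1
  have hulim : Tendsto u atTop (𝓝 (1 - q)) := by
    have h := (tendsto_const_nhds (x := 1 - q)).div hden one_ne_zero
    rwa [div_one] at h
  have hvlim : Tendsto v atTop (𝓝 0) := by
    have h := (((tendsto_add_atTop_iff_nat 1).2 hlim).mul_const (1 - q)).div hden one_ne_zero
    rwa [zero_mul, zero_div] at h
  have hL : ∀ {w : ℕ → ℝ} {l : ℝ}, (∀ n, 0 < w n) → (∀ n, w n < 1) → l ∈ Icc (0 : ℝ) 1 →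
      Tendsto w atTop (𝓝 l) → Tendsto (fun n => rogersL (w n)) atTop (𝓝 (rogersL l)) :=
    fun w0 w1 hl hw => (continuousOn_rogersL _ hl).tendsto.comp
      (tendsto_nhdsWithin_iff.2 ⟨hw, Eventually.of_forall fun n => ⟨(w0 n).le, (w1 n).le⟩⟩)
  have hstart : rogersL (u 0) + rogersL (v 0) = Real.pi ^ 2 / 6 := by
    rw [← rogersL_add_rogersL_one_sub (hu0 0) (hu1 0), eu]
    simp only [hv]
    ring_nf
  have hrefl := rogersL_add_rogersL_one_sub h0 h1
  simp_rw [← euv]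
  rw [hasSum_iff_tendsto_nat_of_nonneg fun n => rogersL_nonneg
    (mul_pos (hu0 n) (hv0 n)).le (mul_le_one₀ (hu1 n).le (hv0 n).le (hv1 n).le)]
  simp_rw [step, Finset.sum_range_sub' (fun n => rogersL (u n) + rogersL (v n))]
  have := ((hL hu0 hu1 ⟨hq.le, by linarith⟩ hulim).add
    (hL hv0 hv1 ⟨le_rfl, zero_le_one⟩ hvlim)).const_sub (rogersL (u 0) + rogersL (v 0))
  convert this using 2
  rw [rogersL_zero]
  linarith

theorem stmt_7 (a : ℝ) (ha : a ∈ Set.Ioo (0 : ℝ) 1) :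
    ∑' n : ℕ, rogersL (4 * a ^ 2 * (1 - a ^ 2) ^ (n + 1) /
        ((1 + a) ^ (n + 2) - (1 - a) ^ (n + 2)) ^ 2) =
      rogersL ((1 - a) / (1 + a)) := by
  obtain ⟨h0, h1⟩ := ha
  have hp : 0 < 1 + a := by linarith
  have hm : 0 < 1 - a := by linarith
  rw [← (hasSum_rogersL_q (q := (1 - a) / (1 + a)) (by positivity)
    (by rw [div_lt_one hp]; linarith)).tsum_eq]
  congr 1
  ext n
  congr 1
  have e1 : 1 - (1 - a) / (1 + a) = 2 * a / (1 + a) := by field_simp; ring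
  have e2 : 1 - ((1 - a) / (1 + a)) ^ (n + 2) =
      ((1 + a) ^ (n + 2) - (1 - a) ^ (n + 2)) / (1 + a) ^ (n + 2) := by
    rw [div_pow]; field_simp
  have e3 : 1 - a ^ 2 = (1 + a) * (1 - a) := by ring
  have hd : (1 + a) ^ (n + 2) - (1 - a) ^ (n + 2) ≠ 0 :=
    (sub_pos.2 (pow_lt_pow_left₀ (by linarith) hm.le (by omega))).ne'
  rw [e1, e2, e3, mul_pow, div_pow, div_pow, div_pow]
  field_simp
  ring
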